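/- arXiv:2204.10787 — 9 statements merged into one kernel-verified Lean document; each statement's English description precedes it below -/
import Mathlib

section
/- (Per-sample Hessian lower bound) Let N ≥ 1, R ≥ 1, S ⊆ {1,…,N}, and θ ∈ ℝ^N with e^{θ_i} ∈ [1/R, R] for all i. Define the N×N matrix M(θ,S) = (1 + ∑_{k∈S} e^{θ_k})^{-2} · [ D + ∑_{i<j, i,j∈S} e^{θ_i + θ_j} (e_i − e_j)(e_i − e_j)^T ], where D is the diagonal matrix with entries D_{ii} = e^{θ_i}·𝟙(i ∈ S) and e_i is the i-th standard basis vector. Then M(θ,S) − (1/(R(1+NR)^2)) · diag(𝟙(1∈S),…,𝟙(N∈S)) is positive semidefinite. -/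
open Matrix

/-- Per-sample Hessian lower bound.  With
`M(θ,S) = (1 + ∑_{k∈S} e^{θ_k})^{-2} [ D + ∑_{i<j, i,j∈S} e^{θ_i+θ_j}(e_i−e_j)(e_i−e_j)ᵀ ]`,
where `D` is diagonal with `D_{ii} = e^{θ_i} 𝟙(i∈S)`, one has
`M(θ,S) ⪰ (1/(R(1+NR)^2)) diag(𝟙(1∈S),…,𝟙(N∈S))` whenever `e^{θ_i} ∈ [1/R, R]`. -/
theorem per_sample_hessian_lower_bound (N : ℕ) (hN : 1 ≤ N) (R : ℝ) (hR : 1 ≤ R)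
    (S : Finset (Fin N)) (θ : Fin N → ℝ)
    (hθ : ∀ i, Real.exp (θ i) ∈ Set.Icc (1 / R) R) :
    (((1 + ∑ k ∈ S, Real.exp (θ k)) ^ 2)⁻¹ •
        (Matrix.diagonal (fun i => if i ∈ S then Real.exp (θ i) else 0) +
          ∑ i : Fin N, ∑ j : Fin N,
            if i < j ∧ i ∈ S ∧ j ∈ S then
              Real.exp (θ i + θ j) •
                Matrix.vecMulVec
                  (fun k => (if k = i then (1 : ℝ) else 0) - (if k = j then 1 else 0))
                  (fun k => (if k = i then (1 : ℝ) else 0) - (if k = j then 1 else 0))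
            else 0) -
      (1 / (R * (1 + (N : ℝ) * R) ^ 2)) •
        Matrix.diagonal (fun i => if i ∈ S then (1 : ℝ) else 0)).PosSemidef := by
  have hR0 : 0 < R := by linarith
  have hsum0 : 0 ≤ ∑ k ∈ S, Real.exp (θ k) :=
    Finset.sum_nonneg fun k _ => (Real.exp_pos _).le
  have hsum : ∑ k ∈ S, Real.exp (θ k) ≤ N * R := by
    calc ∑ k ∈ S, Real.exp (θ k) ≤ ∑ k ∈ S, R := Finset.sum_le_sum fun k _ => (hθ k).2
      _ = (S.card : ℝ) * R := by simp
      _ ≤ N * R := by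
        have h : S.card ≤ N := by simpa using S.card_le_univ
        have h2 : (S.card : ℝ) ≤ N := by exact_mod_cast h
        gcongr
  set T := ∑ k ∈ S, Real.exp (θ k) with hT
  have ha : 0 ≤ ((1 + T) ^ 2)⁻¹ := by positivity
  rw [smul_add, add_sub_right_comm]
  apply Matrix.PosSemidef.add
  · rw [← Matrix.diagonal_smul, ← Matrix.diagonal_smul, Matrix.diagonal_sub]
    apply Matrix.PosSemidef.diagonal
    intro i
    by_cases hi : i ∈ S
    · simp only [Pi.smul_apply, hi, if_true, smul_eq_mul, Pi.zero_apply, mul_one]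
      have h1 : ((1 + (N : ℝ) * R) ^ 2)⁻¹ ≤ ((1 + T) ^ 2)⁻¹ := by gcongr
      have h2 : ((1 + (N : ℝ) * R) ^ 2)⁻¹ * (1 / R) ≤ ((1 + T) ^ 2)⁻¹ * Real.exp (θ i) :=
        mul_le_mul h1 (hθ i).1 (by positivity) ha
      have h3 : 1 / (R * (1 + (N : ℝ) * R) ^ 2) = ((1 + (N : ℝ) * R) ^ 2)⁻¹ * (1 / R) := by
        rw [one_div, mul_inv, one_div, mul_comm]
      rw [h3]
      linarith
    · simp [hi]
  · apply Matrix.PosSemidef.smul _ ha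
    apply Matrix.posSemidef_sum
    intro i _
    apply Matrix.posSemidef_sum
    intro j _
    split_ifs
    · apply Matrix.PosSemidef.smul _ (Real.exp_pos _).le
      exact Matrix.posSemidef_vecMulVec_self_star
        (fun k => (if k = i then (1 : ℝ) else 0) - (if k = j then 1 else 0))
    · exact Matrix.PosSemidef.zero
end

section
/- (Deterministic MLE parameter bound) Let f : ℝ^N → ℝ be twice continuously differentiable, let κ > 0, C ≥ 0, and let n_1,…,n_N > 0. Suppose (i) for all θ ∈ ℝ^N and all d ∈ ℝ^N, d^T (Hess f)(θ) d ≥ (1/κ) ∑_{i=1}^N n_i d_i^2; (ii) |∂f/∂θ_i (θ*)| ≤ √(2 n_i C) for all i; and (iii) f(θ̂) ≤ f(θ*). Then, with Ψ = κ√(2C), it holds that ∑_{i=1}^N ( √(n_i) |θ̂_i − θ*_i| − Ψ )^2 ≤ N Ψ^2, and in particular |θ̂_i − θ*_i| ≤ (√N + 1) Ψ / √(n_i) for every i. -/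
theorem taylor_lower {E : Type*} [NormedAddCommGroup E] [NormedSpace ℝ E] (f : E → ℝ)
    (hf : ContDiff ℝ 2 f) (x d : E) (q : ℝ)
    (h : ∀ θ, q ≤ iteratedFDeriv ℝ 2 f θ ![d, d]) :
    f x + fderiv ℝ f x d + q / 2 ≤ f (x + d) := by
  have hline : ∀ t : ℝ, HasDerivAt (fun t : ℝ => x + t • d) d t := fun t => by
    simpa using ((hasDerivAt_id t).smul_const d).const_add x
  have hd1 : Differentiable ℝ f := hf.differentiable (by norm_num)
  have hd2 : Differentiable ℝ (fderiv ℝ f) :=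
    (hf.fderiv_right (m := 1) (by norm_num)).differentiable (by norm_num)
  have hg : ∀ t : ℝ, HasDerivAt (fun t : ℝ => f (x + t • d)) (fderiv ℝ f (x + t • d) d) t :=
    fun t => (hd1 _).hasFDerivAt.comp_hasDerivAt t (hline t)
  have hg2 : ∀ t : ℝ, HasDerivAt (fun t : ℝ => fderiv ℝ f (x + t • d) d)
      (fderiv ℝ (fderiv ℝ f) (x + t • d) d d) t := fun t => by
    have h1 := (hd2 (x + t • d)).hasFDerivAt.comp_hasDerivAt t (hline t)
    simpa using h1.clm_apply (hasDerivAt_const t d)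
  have hh : ∀ t : ℝ, HasDerivAt (fun t : ℝ => fderiv ℝ f (x + t • d) d - q * t)
      (fderiv ℝ (fderiv ℝ f) (x + t • d) d d - q) t := fun t => by
    simpa using (hg2 t).fun_sub ((hasDerivAt_id t).const_mul q)
  have hmono : Monotone (fun t : ℝ => fderiv ℝ f (x + t • d) d - q * t) := by
    apply monotone_of_deriv_nonneg (fun t => (hh t).differentiableAt)
    intro t
    rw [(hh t).deriv]
    have := h (x + t • d)
    rw [iteratedFDeriv_two_apply] at this
    simpa using this
  have hk : ∀ t : ℝ, HasDerivAt
      (fun t : ℝ => f (x + t • d) - (fderiv ℝ f x d * t + q / 2 * t ^ 2))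
      (fderiv ℝ f (x + t • d) d - (fderiv ℝ f x d + q * t)) t := fun t => by
    have h2 := (hg t).sub (((hasDerivAt_id t).const_mul (fderiv ℝ f x d)).add
      ((hasDerivAt_pow 2 t).const_mul (q / 2)))
    refine HasDerivAt.congr_deriv h2 ?_
    simp
    ring
  have hm : MonotoneOn (fun t : ℝ => f (x + t • d) - (fderiv ℝ f x d * t + q / 2 * t ^ 2))
      (Set.Icc 0 1) := by
    apply monotoneOn_of_deriv_nonneg (convex_Icc 0 1)
    · exact fun t _ => (hk t).continuousAt.continuousWithinAt
    · exact fun t _ => (hk t).differentiableAt.differentiableWithinAt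
    · intro t ht
      rw [interior_Icc] at ht
      rw [(hk t).deriv]
      have := hmono ht.1.le
      simp at this
      linarith
  have := hm (Set.left_mem_Icc.2 zero_le_one) (Set.right_mem_Icc.2 zero_le_one) zero_le_one
  simp at this
  linarith

/-- Deterministic MLE parameter bound.  Let `f : ℝ^N → ℝ` be `C²`, `κ > 0`,
`C ≥ 0`, `n_i > 0`.  If (i) `dᵀ (Hess f)(θ) d ≥ (1/κ) ∑ n_i d_i²` for all `θ, d`,
(ii) `|∂f/∂θ_i(θ*)| ≤ √(2 n_i C)` for all `i`, and (iii) `f(θ̂) ≤ f(θ*)`, then with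
`Ψ = κ√(2C)` one has `∑ (√(n_i)|θ̂_i − θ*_i| − Ψ)² ≤ N Ψ²` and
`|θ̂_i − θ*_i| ≤ (√N + 1)Ψ/√(n_i)` for all `i`. -/
theorem mle_parameter_bound (N : ℕ) (f : (Fin N → ℝ) → ℝ) (hf : ContDiff ℝ 2 f)
    (κ C : ℝ) (hκ : 0 < κ) (hC : 0 ≤ C) (n : Fin N → ℝ) (hn : ∀ i, 0 < n i)
    (θstar θhat : Fin N → ℝ)
    (hHess : ∀ θ d : Fin N → ℝ,
      (1 / κ) * ∑ i, n i * (d i) ^ 2 ≤ iteratedFDeriv ℝ 2 f θ ![d, d])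
    (hGrad : ∀ i, |fderiv ℝ f θstar (Pi.single i 1)| ≤ Real.sqrt (2 * n i * C))
    (hMin : f θhat ≤ f θstar) :
    (∑ i, (Real.sqrt (n i) * |θhat i - θstar i| - κ * Real.sqrt (2 * C)) ^ 2 ≤
        (N : ℝ) * (κ * Real.sqrt (2 * C)) ^ 2) ∧
    ∀ i, |θhat i - θstar i| ≤
        (Real.sqrt N + 1) * (κ * Real.sqrt (2 * C)) / Real.sqrt (n i) := by
  have hT := taylor_lower f hf θstar (θhat - θstar) _ (fun θ => hHess θ (θhat - θstar))
  rw [add_sub_cancel] at hT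
  set d := θhat - θstar with hd
  have hdi : ∀ i, θhat i - θstar i = d i := fun i => rfl
  simp only [hdi]
  set s := Real.sqrt (2 * C) with hs
  have hs0 : 0 ≤ s := Real.sqrt_nonneg _
  have hlin : fderiv ℝ f θstar d = ∑ i, d i * fderiv ℝ f θstar (Pi.single i 1) := by
    conv_lhs => rw [pi_eq_sum_univ' d]
    simp [map_sum, Pi.single_apply, Pi.single, Function.update]
  have hlow : -(s * ∑ i, Real.sqrt (n i) * |d i|) ≤ fderiv ℝ f θstar d := by
    rw [hlin, Finset.mul_sum, ← Finset.sum_neg_distrib]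
    apply Finset.sum_le_sum
    intro i _
    have h1 := hGrad i
    rw [show 2 * n i * C = n i * (2 * C) by ring, Real.sqrt_mul (hn i).le] at h1
    have h2 := mul_le_mul_of_nonneg_left h1 (abs_nonneg (d i))
    rw [← abs_mul] at h2
    have h3 := neg_abs_le (d i * fderiv ℝ f θstar (Pi.single i 1))
    linarith
  have hQ : ∑ i, n i * d i ^ 2 = ∑ i, (Real.sqrt (n i) * |d i|) ^ 2 := by
    refine Finset.sum_congr rfl fun i _ => ?_
    rw [mul_pow, Real.sq_sqrt (hn i).le, sq_abs]
  rw [hQ] at hT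
  set a : Fin N → ℝ := fun i => Real.sqrt (n i) * |d i| with ha
  have hmain : ∑ i, (a i) ^ 2 ≤ 2 * (κ * s) * ∑ i, a i := by
    have h4 : (1 / κ * ∑ i, (a i) ^ 2) ≤ 2 * (s * ∑ i, a i) := by
      simp only [ha] at *
      linarith
    rw [one_div, inv_mul_le_iff₀ hκ] at h4
    linarith
  have hfirst : ∑ i, (a i - κ * s) ^ 2 ≤ (N : ℝ) * (κ * s) ^ 2 := by
    have : ∑ i, (a i - κ * s) ^ 2
        = ∑ i, (a i) ^ 2 - 2 * (κ * s) * ∑ i, a i + (N : ℝ) * (κ * s) ^ 2 := by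
      simp only [sub_sq, Finset.sum_add_distrib, Finset.sum_sub_distrib, Finset.mul_sum]
      simp
      exact Finset.sum_congr rfl fun i _ => by ring
    linarith
  refine ⟨hfirst, fun i => ?_⟩
  rw [le_div_iff₀ (Real.sqrt_pos.2 (hn i))]
  have h5 : (a i - κ * s) ^ 2 ≤ (Real.sqrt N * (κ * s)) ^ 2 := by
    rw [mul_pow, Real.sq_sqrt (Nat.cast_nonneg N)]
    exact (Finset.single_le_sum (f := fun i => (a i - κ * s) ^ 2)
      (fun j _ => sq_nonneg _) (Finset.mem_univ i)).trans hfirst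
  have h7 := le_of_abs_le (abs_le_of_sq_le_sq h5 (by positivity))
  simp only [ha] at h7
  linarith
end

section
/- (Equivalence of LP formulations) Fix n ≥ 1, K ≥ 0, v̂ ∈ ℝ_{>0}^n, ε ∈ ℝ_{≥0}^n, r ∈ [0,1]^n, a ∈ [0,1]^{n×K}, c ∈ ℝ_{≥0}^K, and ω ∈ [0,1]. Define the UCB-LP as: maximize ∑_{S⊆{1,…,n}} ∑_{i∈S} r_i ( v̂_i/(1+∑_{j∈S} v̂_j) + ε_i ) y(S) over y : 2^{{1,…,n}} → ℝ_{≥0} subject to ∑_{S} ∑_{i∈S} a_{ik} ( v̂_i/(1+∑_{j∈S} v̂_j) − ε_i ) y(S) ≤ (1−ω) c_k for all k and ∑_S y(S) = 1. Define the Compact LP as: maximize ∑_{i=1}^n r_i [ (v̂_i + ε_i) x_i + ε_i ∑_{j=1}^n v̂_j y_{ij} ] over (x_0, x, y) ∈ ℝ × ℝ_{≥0}^{n} × ℝ_{≥0}^{n×n} subject to ∑_{i=1}^n a_{ik} [ (v̂_i − ε_i) x_i − ε_i ∑_{j=1}^n v̂_j y_{ij} ] ≤ (1−ω) c_k for all k,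 x_0 + ∑_{i=1}^n v̂_i x_i = 1, x_i ≤ x_0 for all i, and y_{ij} ≤ min{x_i, x_j} for all i, j. Then the optimal objective values (suprema over the respective feasible sets, both of which are nonempty) of the UCB-LP and the Compact LP are equal. -/
open MeasureTheory in
lemma chain_exists {n : ℕ} (x₀ : ℝ) (h0 : 0 ≤ x₀) (x : Fin n → ℝ) (hx : ∀ i, 0 ≤ x i)
    (hx0 : ∀ i, x i ≤ x₀) :
    ∃ w : Finset (Fin n) → ℝ, (∀ S, 0 ≤ w S) ∧ (∑ S, w S = x₀) ∧
      (∀ i j, ∑ S : Finset (Fin n), (if i ∈ S ∧ j ∈ S then w S else 0) = min (x i) (x j)) := by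
  classical
  let g : ℝ → Finset (Fin n) := fun t => Finset.univ.filter (fun i => t ≤ x i)
  let μ : Measure ℝ := volume.restrict (Set.Ioc 0 x₀)
  have hm : ∀ S, MeasurableSet (g ⁻¹' {S}) := by
    intro S
    have : g ⁻¹' {S} = ⋂ i, {t : ℝ | t ≤ x i ↔ i ∈ S} := by
      ext t
      simp [g, Finset.ext_iff]
    rw [this]
    refine MeasurableSet.iInter fun i => ?_
    by_cases hi : i ∈ S
    · simp only [hi, iff_true]; exact measurableSet_Iic
    · simp only [hi, iff_false, not_le]; exact measurableSet_Ioi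
  have hs : ∀ s : Finset (Finset (Fin n)),
      ∑ S ∈ s, μ.real (g ⁻¹' {S}) = μ.real (g ⁻¹' (s : Set (Finset (Fin n)))) := by
    intro s
    exact sum_measureReal_preimage_singleton s (fun S _ => hm S)
  refine ⟨fun S => μ.real (g ⁻¹' {S}), fun S => measureReal_nonneg, ?_, ?_⟩
  · rw [hs]
    simp [μ, h0]
  · intro i j
    rw [← Finset.sum_filter, hs]
    have e : g ⁻¹' ((Finset.univ.filter (fun S : Finset (Fin n) => i ∈ S ∧ j ∈ S) :
        Finset (Finset (Fin n))) : Set (Finset (Fin n))) = Set.Iic (min (x i) (x j)) := by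
      ext t
      simp [g]
    have h1 : Set.Iic (min (x i) (x j)) ∩ Set.Ioc 0 x₀ = Set.Ioc 0 (min (x i) (x j)) := by
      ext t
      have := min_le_left (x i) (x j)
      have := hx0 i
      simp only [Set.mem_inter_iff, Set.mem_Iic, Set.mem_Ioc]
      constructor
      · rintro ⟨a, b, c⟩; exact ⟨b, a⟩
      · rintro ⟨a, b⟩; exact ⟨b, a, by linarith⟩
    rw [e, measureReal_restrict_apply measurableSet_Iic, h1, Real.volume_real_Ioc_of_le]
    · simp
    · exact le_min (hx i) (hx j)

lemma key_id {n : ℕ} (v e p : Fin n → ℝ) (hv : ∀ i, 0 < v i) (w : Finset (Fin n) → ℝ) :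
    ∑ S : Finset (Fin n), (∑ i ∈ S, p i * (v i / (1 + ∑ j ∈ S, v j) + e i)) *
        (w S * (1 + ∑ j ∈ S, v j)) =
      ∑ i, p i * ((v i + e i) * (∑ S : Finset (Fin n), if i ∈ S then w S else 0) +
        e i * ∑ j, v j * ∑ S : Finset (Fin n), if i ∈ S ∧ j ∈ S then w S else 0) := by
  classical
  have h1 : ∀ S : Finset (Fin n), (∑ i ∈ S, p i * (v i / (1 + ∑ j ∈ S, v j) + e i)) *
        (w S * (1 + ∑ j ∈ S, v j)) = ∑ i, p i * ((v i + e i) * (if i ∈ S then w S else 0) +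
        e i * ∑ j, v j * if i ∈ S ∧ j ∈ S then w S else 0) := by
    intro S
    have hV : 0 ≤ ∑ j ∈ S, v j := Finset.sum_nonneg fun j _ => (hv j).le
    have hS : S = Finset.univ.filter (fun i => i ∈ S) := by ext; simp
    rw [Finset.sum_mul]
    have : ∀ F : Fin n → ℝ, ∑ i ∈ S, F i = ∑ i, if i ∈ S then F i else 0 := by
      intro F; rw [← Finset.sum_filter, ← hS]
    rw [this]
    refine Finset.sum_congr rfl fun i _ => ?_
    by_cases hi : i ∈ S
    · have h2 : (∑ j, v j * if i ∈ S ∧ j ∈ S then w S else 0) = (∑ j ∈ S, v j) * w S := by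
        rw [Finset.sum_mul, this]
        refine Finset.sum_congr rfl fun j _ => ?_
        simp [hi]
      rw [h2]
      simp only [hi, if_true]
      have : (1 + ∑ j ∈ S, v j) ≠ 0 := by positivity
      field_simp
      ring
    · simp [hi]
  rw [Finset.sum_congr rfl fun S _ => h1 S, Finset.sum_comm]
  refine Finset.sum_congr rfl fun i _ => ?_
  rw [← Finset.mul_sum, Finset.sum_add_distrib, ← Finset.mul_sum, ← Finset.mul_sum,
    Finset.sum_comm]
  simp only [Finset.mul_sum]

lemma mass_id {n : ℕ} (v : Fin n → ℝ) (w : Finset (Fin n) → ℝ) :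
    ∑ S : Finset (Fin n), w S * (1 + ∑ j ∈ S, v j) =
      ∑ S, w S + ∑ i, v i * ∑ S : Finset (Fin n), if i ∈ S then w S else 0 := by
  classical
  simp only [mul_add, mul_one, Finset.sum_add_distrib, Finset.mul_sum]
  congr 1
  rw [Finset.sum_comm (s := Finset.univ (α := Fin n))]
  refine Finset.sum_congr rfl fun S _ => ?_
  simp [mul_comm]

lemma key_neg {n : ℕ} (v e p : Fin n → ℝ) (hv : ∀ i, 0 < v i) (w : Finset (Fin n) → ℝ) :
    ∑ S : Finset (Fin n), (∑ i ∈ S, p i * (v i / (1 + ∑ j ∈ S, v j) - e i)) *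
        (w S * (1 + ∑ j ∈ S, v j)) =
      ∑ i, p i * ((v i - e i) * (∑ S : Finset (Fin n), if i ∈ S then w S else 0) -
        e i * ∑ j, v j * ∑ S : Finset (Fin n), if i ∈ S ∧ j ∈ S then w S else 0) := by
  have := key_id v (fun i => - e i) p hv w
  simpa only [← sub_eq_add_neg, neg_mul] using this

/-- Equivalence of LP formulations.  The optimal objective value of the
UCB-LP (over distributions `y` on the subsets of `{1,…,n}`) equals the optimal objective
value of the Compact LP (over `(x₀, x, y) ∈ ℝ × ℝ_{≥0}^n × ℝ_{≥0}^{n×n}`). -/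
theorem ucb_lp_compact_lp_equiv (n K : ℕ) (hn : 1 ≤ n)
    (vh ε r : Fin n → ℝ) (a : Fin n → Fin K → ℝ) (c : Fin K → ℝ) (ω : ℝ)
    (hv : ∀ i, 0 < vh i) (hε : ∀ i, 0 ≤ ε i)
    (hr : ∀ i, r i ∈ Set.Icc (0 : ℝ) 1)
    (ha : ∀ i k, a i k ∈ Set.Icc (0 : ℝ) 1)
    (hc : ∀ k, 0 ≤ c k) (hω : ω ∈ Set.Icc (0 : ℝ) 1) :
    sSup {z : ℝ | ∃ y : Finset (Fin n) → ℝ,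
        ((∀ S, 0 ≤ y S) ∧
          (∀ k, ∑ S : Finset (Fin n),
              (∑ i ∈ S, a i k * (vh i / (1 + ∑ j ∈ S, vh j) - ε i)) * y S ≤
            (1 - ω) * c k) ∧
          (∑ S : Finset (Fin n), y S = 1)) ∧
        z = ∑ S : Finset (Fin n),
          (∑ i ∈ S, r i * (vh i / (1 + ∑ j ∈ S, vh j) + ε i)) * y S} =
    sSup {z : ℝ | ∃ (x₀ : ℝ) (x : Fin n → ℝ) (y : Fin n → Fin n → ℝ),
        ((∀ i, 0 ≤ x i) ∧ (∀ i j, 0 ≤ y i j) ∧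
          (∀ k, ∑ i, a i k * ((vh i - ε i) * x i - ε i * ∑ j, vh j * y i j) ≤
            (1 - ω) * c k) ∧
          (x₀ + ∑ i, vh i * x i = 1) ∧
          (∀ i, x i ≤ x₀) ∧
          (∀ i j, y i j ≤ min (x i) (x j))) ∧
        z = ∑ i, r i * ((vh i + ε i) * x i + ε i * ∑ j, vh j * y i j)} := by
  have hpos : ∀ S : Finset (Fin n), 0 < 1 + ∑ j ∈ S, vh j := fun S => by
    have : 0 ≤ ∑ j ∈ S, vh j := Finset.sum_nonneg fun j _ => (hv j).le
    linarith
  apply csSup_eq_csSup_of_forall_exists_le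
  · rintro z ⟨y, ⟨hy, hk, h1⟩, rfl⟩
    obtain ⟨w, rfl⟩ : ∃ w : Finset (Fin n) → ℝ, y = fun S => w S * (1 + ∑ j ∈ S, vh j) :=
      ⟨fun S => y S / (1 + ∑ j ∈ S, vh j), by
        funext S; exact (div_mul_cancel₀ _ (hpos S).ne').symm⟩
    have hw : ∀ S, 0 ≤ w S := fun S => nonneg_of_mul_nonneg_left (hy S) (hpos S)
    simp only [key_neg vh ε _ hv, mass_id] at hk h1
    refine ⟨_, ⟨∑ S, w S, fun i => ∑ S : Finset (Fin n), if i ∈ S then w S else 0,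
      fun i j => ∑ S : Finset (Fin n), if i ∈ S ∧ j ∈ S then w S else 0,
      ⟨?_, ?_, hk, h1, ?_, ?_⟩, rfl⟩, (key_id vh ε r hv w).le⟩
    · intro i; exact Finset.sum_nonneg fun S _ => by split_ifs <;> simp [hw]
    · intro i j; exact Finset.sum_nonneg fun S _ => by split_ifs <;> simp [hw]
    · intro i; exact Finset.sum_le_sum fun S _ => by split_ifs <;> simp [hw]
    · intro i j
      refine le_min ?_ ?_ <;> refine Finset.sum_le_sum fun S _ => ?_
      · by_cases h : i ∈ S <;> by_cases h' : j ∈ S <;> simp [h, h', hw]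
      · by_cases h : i ∈ S <;> by_cases h' : j ∈ S <;> simp [h, h', hw]
  · rintro z ⟨x₀, x, y, ⟨hx, hy, hk, h1, hx0, hxy⟩, rfl⟩
    have h0 : 0 ≤ x₀ := (hx ⟨0, hn⟩).trans (hx0 ⟨0, hn⟩)
    obtain ⟨w, hw, hw0, hwm⟩ := chain_exists x₀ h0 x hx hx0
    have hwx : ∀ i, (∑ S : Finset (Fin n), if i ∈ S then w S else 0) = x i := by
      intro i
      have := hwm i i
      simpa using this
    have hsum : ∀ i, ε i * ∑ j, vh j * y i j ≤ ε i * ∑ j, vh j * min (x i) (x j) := fun i =>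
      mul_le_mul_of_nonneg_left (Finset.sum_le_sum fun j _ =>
        mul_le_mul_of_nonneg_left (hxy i j) (hv j).le) (hε i)
    refine ⟨_, ⟨fun S => w S * (1 + ∑ j ∈ S, vh j), ⟨?_, ?_, ?_⟩, rfl⟩, ?_⟩
    · intro S; exact mul_nonneg (hw S) (hpos S).le
    · intro k
      simp only [key_neg vh ε _ hv, hwx, hwm]
      refine le_trans (Finset.sum_le_sum fun i _ => ?_) (hk k)
      exact mul_le_mul_of_nonneg_left (by linarith [hsum i]) (ha i k).1
    · simp only [mass_id, hwx, hw0]; exact h1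
    · simp only [key_id vh ε _ hv, hwx, hwm]
      refine Finset.sum_le_sum fun i _ => ?_
      exact mul_le_mul_of_nonneg_left (by linarith [hsum i]) (hr i).1
end

section
/- (Embedding of assortments into the polytope) Fix n ≥ 1, v̂ ∈ ℝ_{>0}^n, ε ∈ ℝ_{≥0}^n, r ∈ ℝ_{≥0}^n, a ∈ ℝ_{≥0}^{n×K}, μ ∈ ℝ_{≥0}^K, and let 𝒫, f, and L be as follows: 𝒫 = { (x_0, x, y) ∈ ℝ × ℝ_{≥0}^{n} × ℝ_{≥0}^{n×n} : x_0 + ∑_i v̂_i x_i = 1, x_i ≤ x_0 ∀i, y_{ij} ≤ min{x_i,x_j} ∀i,j }; f(S) = ∑_{i∈S} [ r_i ( v̂_i/(1+∑_{j∈S} v̂_j) + ε_i ) − (∑_k a_{ik} μ_k)( v̂_i/(1+∑_{j∈S} v̂_j) − ε_i ) ]; L(x_0,x,y) = ∑_i r_i [ (v̂_i+ε_i) x_i + ε_i ∑_j v̂_j y_{ij} ] − ∑_i (∑_k a_{ik} μ_k)[ (v̂_i−ε_i) x_i − ε_i ∑_j v̂_j y_{ij} ]. For every S ⊆ {1,…,n},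 the point defined by x̂_0 = 1/(1+∑_{j∈S} v̂_j), x̂_i = 𝟙(i∈S)·x̂_0, and ŷ_{ij} = 𝟙(i∈S)·𝟙(j∈S)·x̂_0 belongs to 𝒫 and satisfies L(x̂_0, x̂, ŷ) = f(S). -/
/-- The compact polytope `𝒫`. -/
def compactPolytope (n : ℕ) (vh : Fin n → ℝ) :
    Set (ℝ × (Fin n → ℝ) × (Fin n → Fin n → ℝ)) :=
  {p | (∀ i, 0 ≤ p.2.1 i) ∧ (∀ i j, 0 ≤ p.2.2 i j) ∧
    (p.1 + ∑ i, vh i * p.2.1 i = 1) ∧ (∀ i, p.2.1 i ≤ p.1) ∧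
    ∀ i j, p.2.2 i j ≤ min (p.2.1 i) (p.2.1 j)}

/-- The set function `f(S)` of the Lagrangian subproblem. -/
noncomputable def lagrangianSetFn {n K : ℕ} (vh ε r : Fin n → ℝ)
    (a : Fin n → Fin K → ℝ) (μ : Fin K → ℝ) (S : Finset (Fin n)) : ℝ :=
  ∑ i ∈ S, (r i * (vh i / (1 + ∑ j ∈ S, vh j) + ε i) -
    (∑ k, a i k * μ k) * (vh i / (1 + ∑ j ∈ S, vh j) - ε i))

/-- The linear objective `L(x₀, x, y)` of the Lagrangian subproblem. -/
noncomputable def lagrangianLinObj {n K : ℕ} (vh ε r : Fin n → ℝ)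
    (a : Fin n → Fin K → ℝ) (μ : Fin K → ℝ)
    (p : ℝ × (Fin n → ℝ) × (Fin n → Fin n → ℝ)) : ℝ :=
  ∑ i, r i * ((vh i + ε i) * p.2.1 i + ε i * ∑ j, vh j * p.2.2 i j) -
    ∑ i, (∑ k, a i k * μ k) * ((vh i - ε i) * p.2.1 i - ε i * ∑ j, vh j * p.2.2 i j)

/-- Embedding of assortments into the polytope.  For every
`S ⊆ {1,…,n}`, the point `x̂₀ = 1/(1+∑_{j∈S} v̂_j)`, `x̂_i = 𝟙(i∈S)·x̂₀`,
`ŷ_{ij} = 𝟙(i∈S)𝟙(j∈S)·x̂₀` belongs to `𝒫` and satisfies `L(x̂₀,x̂,ŷ) = f(S)`. -/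
theorem assortment_embedding (n K : ℕ) (hn : 1 ≤ n)
    (vh ε r : Fin n → ℝ) (a : Fin n → Fin K → ℝ) (μ : Fin K → ℝ)
    (hv : ∀ i, 0 < vh i) (hε : ∀ i, 0 ≤ ε i) (hr : ∀ i, 0 ≤ r i)
    (ha : ∀ i k, 0 ≤ a i k) (hμ : ∀ k, 0 ≤ μ k)
    (S : Finset (Fin n)) :
    ((1 / (1 + ∑ j ∈ S, vh j),
        fun i => if i ∈ S then 1 / (1 + ∑ j ∈ S, vh j) else 0,
        fun i j => if i ∈ S ∧ j ∈ S then 1 / (1 + ∑ j ∈ S, vh j) else 0) ∈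
      compactPolytope n vh) ∧
    lagrangianLinObj vh ε r a μ
        (1 / (1 + ∑ j ∈ S, vh j),
          fun i => if i ∈ S then 1 / (1 + ∑ j ∈ S, vh j) else 0,
          fun i j => if i ∈ S ∧ j ∈ S then 1 / (1 + ∑ j ∈ S, vh j) else 0) =
      lagrangianSetFn vh ε r a μ S := by
  have hV : 0 < 1 + ∑ j ∈ S, vh j := by
    have := Finset.sum_nonneg (fun j (_ : j ∈ S) => (hv j).le)
    linarith
  have hsum : ∀ c : ℝ, ∑ j, vh j * (if j ∈ S then c else 0) = (∑ j ∈ S, vh j) * c := by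
    intro c
    simp [Finset.sum_mul, Finset.sum_ite_mem]
  generalize hx : 1 / (1 + ∑ j ∈ S, vh j) = x
  have hx0 : 0 < x := by rw [← hx]; positivity
  have hxV : x + (∑ j ∈ S, vh j) * x = 1 := by
    rw [← hx]; field_simp
  refine ⟨⟨?_, ?_, ?_, ?_, ?_⟩, ?_⟩
  · intro i
    dsimp only
    split_ifs <;> linarith
  · intro i j
    dsimp only
    split_ifs <;> linarith
  · dsimp only
    rw [hsum, hxV]
  · intro i
    dsimp only
    split_ifs <;> linarith
  · intro i j
    dsimp only
    by_cases hi : i ∈ S <;> by_cases hj : j ∈ S <;> simp [hi, hj, hx0.le]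
  · unfold lagrangianLinObj lagrangianSetFn
    dsimp only
    rw [← Finset.sum_sub_distrib, ← Finset.sum_subset (Finset.subset_univ S)]
    · refine Finset.sum_congr rfl fun i hi => ?_
      simp only [hi, true_and, if_true, hsum]
      have e : vh i / (1 + ∑ j ∈ S, vh j) = vh i * x := by rw [← hx]; ring
      rw [e]
      linear_combination (r i * ε i + (∑ k, a i k * μ k) * ε i) * hxV
    · intro i _ hi
      simp [hi]
end

section
/- (Extreme points of the compact polytope) Fix n ≥ 1 and v̂ ∈ ℝ_{>0}^n, and define 𝒫 = { (x_0, x, y) ∈ ℝ × ℝ_{≥0}^{n} × ℝ_{≥0}^{n×n} : x_0 + ∑_{i=1}^n v̂_i x_i = 1, x_i ≤ x_0 for all i, y_{ij} ≤ min{x_i, x_j} for all i,j }. Then every extreme point (x̂_0, x̂, ŷ) of 𝒫 satisfies x̂_i ∈ {0, x̂_0} for every i ∈ {1,…,n}. -/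
/-- Apply a scalar function to all coordinates and rescale. -/
theorem scaled_mem (n : ℕ) (vh : Fin n → ℝ)
    (p : ℝ × (Fin n → ℝ) × (Fin n → Fin n → ℝ))
    (hp : p ∈ compactPolytope n vh) (φ : ℝ → ℝ) (hm : Monotone φ) (h0 : φ 0 = 0)
    (a : ℝ) (ha : 0 < a) (hs : φ p.1 + ∑ i, vh i * φ (p.2.1 i) = a) :
    ((a⁻¹ * φ p.1, fun i => a⁻¹ * φ (p.2.1 i), fun i j => a⁻¹ * φ (p.2.2 i j)) :
      ℝ × (Fin n → ℝ) × (Fin n → Fin n → ℝ)) ∈ compactPolytope n vh := by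
  obtain ⟨h1, h2, h3, h4, h5⟩ := hp
  have hi : 0 ≤ a⁻¹ := (inv_pos.mpr ha).le
  have hn : ∀ s, 0 ≤ s → 0 ≤ φ s := fun s h => h0 ▸ hm h
  refine ⟨fun i => mul_nonneg hi (hn _ (h1 i)), fun i j => mul_nonneg hi (hn _ (h2 i j)), ?_,
    fun i => mul_le_mul_of_nonneg_left (hm (h4 i)) hi, fun i j => le_min ?_ ?_⟩
  · have : ∑ i, vh i * (a⁻¹ * φ (p.2.1 i)) = a⁻¹ * ∑ i, vh i * φ (p.2.1 i) := by
      rw [Finset.mul_sum]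
      exact Finset.sum_congr rfl fun i _ => by ring
    show a⁻¹ * φ p.1 + ∑ i, vh i * (a⁻¹ * φ (p.2.1 i)) = 1
    rw [this, ← mul_add, hs, inv_mul_cancel₀ ha.ne']
  · exact mul_le_mul_of_nonneg_left (hm ((h5 i j).trans (min_le_left _ _))) hi
  · exact mul_le_mul_of_nonneg_left (hm ((h5 i j).trans (min_le_right _ _))) hi

/-- Extreme points of the compact polytope.  Every extreme point
`(x̂₀, x̂, ŷ)` of `𝒫` satisfies `x̂_i ∈ {0, x̂₀}` for every `i`. -/
theorem extreme_points_compact_polytope (n : ℕ) (hn : 1 ≤ n)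
    (vh : Fin n → ℝ) (hv : ∀ i, 0 < vh i)
    (p : ℝ × (Fin n → ℝ) × (Fin n → Fin n → ℝ))
    (hp : p ∈ Set.extremePoints ℝ (compactPolytope n vh)) :
    ∀ i, p.2.1 i = 0 ∨ p.2.1 i = p.1 := by
  intro i
  by_contra hcon
  push Not at hcon
  obtain ⟨hne0, hnex⟩ := hcon
  rw [mem_extremePoints] at hp
  obtain ⟨hpP, hext⟩ := hp
  have hpP' := hpP
  obtain ⟨h1, h2, h3, h4, h5⟩ := hpP'
  have ht : 0 < p.2.1 i := lt_of_le_of_ne (h1 i) (Ne.symm hne0)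
  have htx : p.2.1 i < p.1 := lt_of_le_of_ne (h4 i) hnex
  set t := p.2.1 i with htdef
  let φ : ℝ → ℝ := fun s => min s t
  let ψ : ℝ → ℝ := fun s => max (s - t) 0
  have hsum : ∀ s, φ s + ψ s = s := by
    intro s
    simp only [φ, ψ]
    rcases le_total s t with h | h
    · rw [min_eq_left h, max_eq_right (by linarith)]; ring
    · rw [min_eq_right h, max_eq_left (by linarith)]; ring
  have hφm : Monotone φ := fun x y h => min_le_min_right t h
  have hψm : Monotone ψ := fun x y h => max_le_max_right 0 (by linarith)
  have hφ0 : φ 0 = 0 := min_eq_left ht.le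
  have hψ0 : ψ 0 = 0 := max_eq_right (by linarith)
  have hφx : φ p.1 = t := min_eq_right htx.le
  have hψx : ψ p.1 = p.1 - t := max_eq_left (by linarith)
  obtain ⟨a, ha⟩ : ∃ a, φ p.1 + ∑ j, vh j * φ (p.2.1 j) = a := ⟨_, rfl⟩
  obtain ⟨b, hb⟩ : ∃ b, ψ p.1 + ∑ j, vh j * ψ (p.2.1 j) = b := ⟨_, rfl⟩
  have hS1 : 0 ≤ ∑ j, vh j * φ (p.2.1 j) := Finset.sum_nonneg fun j _ =>
    mul_nonneg (hv j).le (hφ0 ▸ hφm (h1 j))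
  have hS2 : 0 ≤ ∑ j, vh j * ψ (p.2.1 j) := Finset.sum_nonneg fun j _ =>
    mul_nonneg (hv j).le (hψ0 ▸ hψm (h1 j))
  have hapos : 0 < a := by linarith
  have hbpos : 0 < b := by linarith
  have hab : a + b = 1 := by
    have : ∑ j, vh j * φ (p.2.1 j) + ∑ j, vh j * ψ (p.2.1 j) = ∑ j, vh j * p.2.1 j := by
      rw [← Finset.sum_add_distrib]
      exact Finset.sum_congr rfl fun j _ => by rw [← mul_add, hsum]
    have := hsum p.1
    linarith
  have key : ∀ s, a * (a⁻¹ * φ s) + b * (b⁻¹ * ψ s) = s := by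
    intro s
    rw [mul_inv_cancel_left₀ hapos.ne', mul_inv_cancel_left₀ hbpos.ne', hsum]
  have hE := hext _ (scaled_mem n vh p hpP φ hφm hφ0 a hapos ha)
    _ (scaled_mem n vh p hpP ψ hψm hψ0 b hbpos hb)
    ⟨a, b, hapos, hbpos, hab, by
      refine Prod.ext ?_ (Prod.ext ?_ ?_)
      · exact key _
      · funext j
        exact key _
      · funext j k
        exact key _⟩
  have hE1 := congrFun (congrArg (fun q => q.2.1) hE.1) i
  have hE2 : a⁻¹ * φ t = t := hE1
  have hφt : φ t = t := min_self t
  rw [hφt] at hE2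
  have : a * t = t := by
    calc a * t = a * (a⁻¹ * t) := by rw [hE2]
      _ = t := mul_inv_cancel_left₀ hapos.ne' t
  nlinarith [mul_pos hbpos ht]
end

section
/- (Optimal subsets from extreme optimal solutions) Fix n ≥ 1, v̂ ∈ ℝ_{>0}^n, ε ∈ ℝ_{≥0}^n, r ∈ ℝ_{≥0}^n, a ∈ ℝ_{≥0}^{n×K}, μ ∈ ℝ_{≥0}^K, and let 𝒫, f, L be defined by: 𝒫 = { (x_0, x, y) ∈ ℝ × ℝ_{≥0}^{n} × ℝ_{≥0}^{n×n} : x_0 + ∑_i v̂_i x_i = 1, x_i ≤ x_0 ∀i, y_{ij} ≤ min{x_i,x_j} ∀i,j }; f(S) = ∑_{i∈S} [ r_i ( v̂_i/(1+∑_{j∈S} v̂_j) + ε_i ) − (∑_k a_{ik} μ_k)( v̂_i/(1+∑_{j∈S} v̂_j) − ε_i ) ]; L(x_0,x,y) = ∑_i r_i [ (v̂_i+ε_i) x_i + ε_i ∑_j v̂_j y_{ij} ] − ∑_i (∑_k a_{ik} μ_k)[ (v̂_i−ε_i) x_i − ε_i ∑_j v̂_j y_{ij} ]. If (x_0^*,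 x^*, y^*) is an extreme point of 𝒫 that maximizes L over 𝒫, then the set S^* = { i : x_i^* ≠ 0 } maximizes f over all subsets of {1,…,n}, and max_{S ⊆ {1,…,n}} f(S) = L(x_0^*, x^*, y^*). -/
lemma cp_scale {n : ℕ} (vh : Fin n → ℝ) (φ : ℝ → ℝ) (hφ : Monotone φ) (h0 : φ 0 = 0)
    (p : ℝ × (Fin n → ℝ) × (Fin n → Fin n → ℝ)) (hp : p ∈ compactPolytope n vh)
    (N : ℝ) (hN : 0 < N) (hNe : φ p.1 + ∑ i, vh i * φ (p.2.1 i) = N) :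
    ((N⁻¹ * φ p.1, fun i => N⁻¹ * φ (p.2.1 i), fun i j => N⁻¹ * φ (p.2.2 i j)) :
      ℝ × (Fin n → ℝ) × (Fin n → Fin n → ℝ)) ∈ compactPolytope n vh := by
  obtain ⟨h1, h2, h3, h4, h5⟩ := hp
  have hi : 0 ≤ N⁻¹ := (inv_pos.mpr hN).le
  have hpos : ∀ s, 0 ≤ s → 0 ≤ φ s := fun s hs => h0 ▸ hφ hs
  refine ⟨fun i => mul_nonneg hi (hpos _ (h1 i)), fun i j => mul_nonneg hi (hpos _ (h2 i j)),
    ?_, fun i => mul_le_mul_of_nonneg_left (hφ (h4 i)) hi, fun i j => le_min ?_ ?_⟩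
  · have : ∀ i, vh i * (N⁻¹ * φ (p.2.1 i)) = N⁻¹ * (vh i * φ (p.2.1 i)) := fun i => by ring
    simp only [this]
    rw [← Finset.mul_sum, ← mul_add, hNe, inv_mul_cancel₀ hN.ne']
  · exact mul_le_mul_of_nonneg_left (hφ ((h5 i j).trans (min_le_left _ _))) hi
  · exact mul_le_mul_of_nonneg_left (hφ ((h5 i j).trans (min_le_right _ _))) hi

lemma cp_extreme {n : ℕ} (vh : Fin n → ℝ) (hv : ∀ i, 0 < vh i)
    (p : ℝ × (Fin n → ℝ) × (Fin n → Fin n → ℝ))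
    (hext : p ∈ Set.extremePoints ℝ (compactPolytope n vh)) (m : Fin n) (hm : p.2.1 m ≠ 0) :
    p.2.1 m = p.1 := by
  by_contra hne
  obtain ⟨hp, hE⟩ := mem_extremePoints.mp hext
  obtain ⟨h1, h2, h3, h4, h5⟩ := id hp
  set c := p.2.1 m with hc
  have hc0 : 0 < c := lt_of_le_of_ne (h1 m) (Ne.symm hm)
  have hc1 : c < p.1 := lt_of_le_of_ne (h4 m) hne
  have hadd : ∀ s : ℝ, min s c + max (s - c) 0 = s := by
    intro s
    rcases le_total s c with h | h
    · rw [min_eq_left h, max_eq_right (by linarith)]; ring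
    · rw [min_eq_right h, max_eq_left (by linarith)]; ring
  let φ : ℝ → ℝ := fun s => min s c
  let ψ : ℝ → ℝ := fun s => max (s - c) 0
  have hφ : Monotone φ := fun s t h => min_le_min_right c h
  have hψ : Monotone ψ := fun s t h => max_le_max_right 0 (by linarith)
  have hφ0 : φ 0 = 0 := min_eq_left hc0.le
  have hψ0 : ψ 0 = 0 := max_eq_right (by linarith)
  have hφx : φ p.1 = c := min_eq_right hc1.le
  have hψx : ψ p.1 = p.1 - c := max_eq_left (by linarith)
  obtain ⟨N, hN⟩ : ∃ N, φ p.1 + ∑ i, vh i * φ (p.2.1 i) = N := ⟨_, rfl⟩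
  obtain ⟨M, hM⟩ : ∃ M, ψ p.1 + ∑ i, vh i * ψ (p.2.1 i) = M := ⟨_, rfl⟩
  have hNpos : 0 < N := by
    have : 0 ≤ ∑ i, vh i * φ (p.2.1 i) :=
      Finset.sum_nonneg fun i _ => mul_nonneg (hv i).le (hφ0 ▸ hφ (h1 i))
    linarith
  have hMpos : 0 < M := by
    have : 0 ≤ ∑ i, vh i * ψ (p.2.1 i) :=
      Finset.sum_nonneg fun i _ => mul_nonneg (hv i).le (hψ0 ▸ hψ (h1 i))
    linarith
  have hadd' : ∀ s, φ s + ψ s = s := hadd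
  have hNM : N + M = 1 := by
    rw [← hN, ← hM, ← h3, add_add_add_comm, ← Finset.sum_add_distrib, hadd']
    simp only [← mul_add, hadd']
  have key := hE _ (cp_scale vh φ hφ hφ0 p hp N hNpos hN) _
    (cp_scale vh ψ hψ hψ0 p hp M hMpos hM) ⟨N, M, hNpos, hMpos, hNM, ?_⟩
  · have k1 := congrArg Prod.fst key.1
    have k2 := congrFun (congrArg (fun q => q.2.1) key.1) m
    have e : φ (p.2.1 m) = c := min_self c
    simp only [hφx, e] at k1 k2
    exact hne (k2.symm.trans k1)
  · have e : ∀ s, N * (N⁻¹ * φ s) + M * (M⁻¹ * ψ s) = s := fun s => by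
      rw [mul_inv_cancel_left₀ hNpos.ne', mul_inv_cancel_left₀ hMpos.ne', hadd']
    refine Prod.ext ?_ (Prod.ext ?_ ?_)
    · simpa using e p.1
    · funext i
      simpa using e (p.2.1 i)
    · funext i j
      simpa using e (p.2.2 i j)

/-- The vertex associated with a subset. -/
noncomputable def cpVertex {n : ℕ} (vh : Fin n → ℝ) (S : Finset (Fin n)) :
    ℝ × (Fin n → ℝ) × (Fin n → Fin n → ℝ) :=
  ((1 + ∑ j ∈ S, vh j)⁻¹, fun i => if i ∈ S then (1 + ∑ j ∈ S, vh j)⁻¹ else 0,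
    fun i j => if i ∈ S then (if j ∈ S then (1 + ∑ j ∈ S, vh j)⁻¹ else 0) else 0)

lemma cpVertex_mem {n : ℕ} (vh : Fin n → ℝ) (hv : ∀ i, 0 < vh i) (S : Finset (Fin n)) :
    cpVertex vh S ∈ compactPolytope n vh := by
  have hpos : 0 < 1 + ∑ j ∈ S, vh j := by
    have : 0 ≤ ∑ j ∈ S, vh j := Finset.sum_nonneg fun i _ => (hv i).le
    linarith
  unfold cpVertex
  generalize hV : 1 + ∑ j ∈ S, vh j = V at *
  have hi : 0 ≤ V⁻¹ := (inv_pos.mpr hpos).le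
  refine ⟨fun i => ?_, fun i j => ?_, ?_, fun i => ?_, fun i j => ?_⟩
  · dsimp only; split_ifs <;> simp [hi]
  · dsimp only; split_ifs <;> simp [hi]
  · simp only [mul_ite, mul_zero, Finset.sum_ite_mem, Finset.univ_inter]
    rw [← Finset.sum_mul, ← one_add_mul, hV, mul_inv_cancel₀ hpos.ne']
  · dsimp only; split_ifs <;> simp [hi]
  · dsimp only; split_ifs <;> simp [hi]

lemma cpVertex_obj {n K : ℕ} (vh ε r : Fin n → ℝ) (a : Fin n → Fin K → ℝ) (μ : Fin K → ℝ)
    (hv : ∀ i, 0 < vh i) (S : Finset (Fin n)) :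
    lagrangianLinObj vh ε r a μ (cpVertex vh S) = lagrangianSetFn vh ε r a μ S := by
  have hpos : 0 < 1 + ∑ j ∈ S, vh j := by
    have : 0 ≤ ∑ j ∈ S, vh j := Finset.sum_nonneg fun i _ => (hv i).le
    linarith
  unfold lagrangianLinObj lagrangianSetFn cpVertex
  rw [← Finset.sum_sub_distrib, ← Finset.sum_subset (Finset.subset_univ S)]
  · refine Finset.sum_congr rfl fun i hi => ?_
    simp only [hi, if_true, mul_ite, mul_zero, Finset.sum_ite_mem, Finset.univ_inter]
    rw [← Finset.sum_mul]
    generalize (∑ k, a i k * μ k) = A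
    generalize (∑ j ∈ S, vh j) = V at *
    field_simp
    ring
  · intro i _ hi
    simp [hi]

/-- Optimal subsets from extreme optimal solutions.  If
`(x₀*, x*, y*)` is an extreme point of `𝒫` maximizing `L` over `𝒫`, then
`S* = {i : x*_i ≠ 0}` maximizes `f` over subsets of `{1,…,n}`, and
`max_S f(S) = L(x₀*, x*, y*)`. -/
theorem optimal_subset_from_extreme_point (n K : ℕ) (hn : 1 ≤ n)
    (vh ε r : Fin n → ℝ) (a : Fin n → Fin K → ℝ) (μ : Fin K → ℝ)
    (hv : ∀ i, 0 < vh i) (hε : ∀ i, 0 ≤ ε i) (hr : ∀ i, 0 ≤ r i)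
    (ha : ∀ i k, 0 ≤ a i k) (hμ : ∀ k, 0 ≤ μ k)
    (p : ℝ × (Fin n → ℝ) × (Fin n → Fin n → ℝ))
    (hext : p ∈ Set.extremePoints ℝ (compactPolytope n vh))
    (hopt : ∀ q ∈ compactPolytope n vh,
      lagrangianLinObj vh ε r a μ q ≤ lagrangianLinObj vh ε r a μ p)
    (Sstar : Finset (Fin n))
    (hSstar : Sstar = Finset.univ.filter fun i => p.2.1 i ≠ 0) :
    (∀ S : Finset (Fin n),
      lagrangianSetFn vh ε r a μ S ≤ lagrangianSetFn vh ε r a μ Sstar) ∧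
    lagrangianSetFn vh ε r a μ Sstar = lagrangianLinObj vh ε r a μ p := by
  have hp := hext.1
  have hx := cp_extreme vh hv p hext
  obtain ⟨h1, h2, h3, h4, h5⟩ := id hp
  have hpos : 0 < 1 + ∑ j ∈ Sstar, vh j := by
    have : 0 ≤ ∑ j ∈ Sstar, vh j := Finset.sum_nonneg fun i _ => (hv i).le
    linarith
  have hmem : ∀ i, i ∈ Sstar ↔ p.2.1 i ≠ 0 := fun i => by simp [hSstar]
  have hxi : ∀ i, p.2.1 i = if i ∈ Sstar then p.1 else 0 := by
    intro i
    split_ifs with h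
    · exact hx i ((hmem i).1 h)
    · by_contra h'
      exact h ((hmem i).2 h')
  have hp1 : p.1 = (1 + ∑ j ∈ Sstar, vh j)⁻¹ := by
    simp only [hxi, mul_ite, mul_zero, Finset.sum_ite_mem, Finset.univ_inter] at h3
    rw [← Finset.sum_mul, ← one_add_mul] at h3
    exact eq_inv_of_mul_eq_one_right h3
  have hvx : ∀ i, (cpVertex vh Sstar).2.1 i = p.2.1 i := fun i => by
    rw [hxi, hp1]; rfl
  have hvy : ∀ i j, p.2.2 i j ≤ (cpVertex vh Sstar).2.2 i j := fun i j => by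
    have a1 := (h5 i j).trans (min_le_left _ _)
    have a2 := (h5 i j).trans (min_le_right _ _)
    rw [hxi, hp1] at a1 a2
    simp only [cpVertex]
    split_ifs at * <;> assumption
  have hle : lagrangianLinObj vh ε r a μ p ≤ lagrangianLinObj vh ε r a μ (cpVertex vh Sstar) := by
    unfold lagrangianLinObj
    have hs : ∀ i, ε i * ∑ j, vh j * p.2.2 i j
        ≤ ε i * ∑ j, vh j * (cpVertex vh Sstar).2.2 i j := fun i =>
      mul_le_mul_of_nonneg_left (Finset.sum_le_sum fun j _ =>
        mul_le_mul_of_nonneg_left (hvy i j) (hv j).le) (hε i)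
    refine sub_le_sub (Finset.sum_le_sum fun i _ => ?_) (Finset.sum_le_sum fun i _ => ?_)
    · rw [hvx]
      exact mul_le_mul_of_nonneg_left (by linarith [hs i]) (hr i)
    · rw [hvx]
      exact mul_le_mul_of_nonneg_left (by linarith [hs i])
        (Finset.sum_nonneg fun k _ => mul_nonneg (ha i k) (hμ k))
  have heq : lagrangianSetFn vh ε r a μ Sstar = lagrangianLinObj vh ε r a μ p := by
    rw [← cpVertex_obj vh ε r a μ hv]
    exact le_antisymm (hopt _ (cpVertex_mem vh hv _)) hle
  refine ⟨fun S => ?_, heq⟩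
  rw [heq, ← cpVertex_obj vh ε r a μ hv]
  exact hopt _ (cpVertex_mem vh hv S)
end

section
/- (Recovery formula gives a probability distribution) Let n ≥ 1, v ∈ ℝ_{>0}^n, and let x_0 ≥ x_1 ≥ x_2 ≥ … ≥ x_n ≥ 0 be reals satisfying x_0 + ∑_{i=1}^n v_i x_i = 1. For i = 0,1,…,n, define S_i = {1,…,i} (with S_0 = ∅), V(S_i) = ∑_{j∈S_i} v_j, and ŵ(S_i) = (x_i − x_{i+1})(1 + V(S_i)), with the convention x_{n+1} = 0. Then ŵ(S_i) ≥ 0 for all i = 0,1,…,n, and ∑_{i=0}^{n} ŵ(S_i) = 1. -/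
/-- Recovery formula gives a probability distribution.  Products are
`1, …, n`; `S_i = {1,…,i}` is encoded as `Finset.Icc 1 i`, `V(S_i) = ∑_{j∈S_i} v j`,
and `ŵ(S_i) = (x i − x (i+1)) (1 + V(S_i))` with the convention `x (n+1) = 0`.
If `x 0 ≥ x 1 ≥ … ≥ x n ≥ 0` and `x 0 + ∑_{i=1}^n v i · x i = 1`, then `ŵ(S_i) ≥ 0` for
`i = 0,…,n` and `∑_{i=0}^n ŵ(S_i) = 1`. -/
theorem recovery_probability_distribution (n : ℕ) (hn : 1 ≤ n)
    (v x : ℕ → ℝ)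
    (hv : ∀ i ∈ Finset.Icc 1 n, 0 < v i)
    (hdec : ∀ i < n, x (i + 1) ≤ x i)
    (hlast : 0 ≤ x n)
    (hconv : x (n + 1) = 0)
    (hsum : x 0 + ∑ i ∈ Finset.Icc 1 n, v i * x i = 1) :
    (∀ i ≤ n, 0 ≤ (x i - x (i + 1)) * (1 + ∑ j ∈ Finset.Icc 1 i, v j)) ∧
    ∑ i ∈ Finset.range (n + 1),
        (x i - x (i + 1)) * (1 + ∑ j ∈ Finset.Icc 1 i, v j) = 1 := by
  have key : ∀ m : ℕ, ∑ i ∈ Finset.range (m + 1),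
        (x i - x (i + 1)) * (1 + ∑ j ∈ Finset.Icc 1 i, v j)
      = x 0 + ∑ i ∈ Finset.Icc 1 m, v i * x i
        - x (m + 1) * (1 + ∑ j ∈ Finset.Icc 1 m, v j) := by
    intro m
    induction m with
    | zero => simp
    | succ k ih =>
      rw [Finset.sum_range_succ, ih, Finset.sum_Icc_succ_top (by omega),
        Finset.sum_Icc_succ_top (by omega)]
      ring
  refine ⟨?_, ?_⟩
  · intro i hi
    apply mul_nonneg
    · rcases Nat.lt_or_eq_of_le hi with h | h
      · linarith [hdec i h]
      · subst h
        rw [hconv]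
        linarith
    · have : 0 ≤ ∑ j ∈ Finset.Icc 1 i, v j := by
        apply Finset.sum_nonneg
        intro j hj
        rw [Finset.mem_Icc] at hj
        exact (hv j (Finset.mem_Icc.mpr ⟨hj.1, hj.2.trans hi⟩)).le
      linarith
  · rw [key n, hconv, hsum]
    ring
end

section
/- (Recovery telescoping identities) Let n ≥ 1, v ∈ ℝ_{>0}^n, and let x_0 ≥ x_1 ≥ x_2 ≥ … ≥ x_n ≥ 0 be reals satisfying x_0 + ∑_{j=1}^n v_j x_j = 1. For i = 0,1,…,n, define S_i = {1,…,i}, V(S_i) = ∑_{j∈S_i} v_j, and ŵ(S_i) = (x_i − x_{i+1})(1 + V(S_i)) with x_{n+1} = 0. Then for every i ∈ {1,…,n}: (a) ∑_{k=i}^{n} ŵ(S_k) · v_i/(1 + V(S_k)) = v_i x_i; and (b) ∑_{k=i}^{n} ŵ(S_k) = x_i + ∑_{j=1}^{n} v_j · min{x_i, x_j}. -/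
/-- Recovery telescoping identities.  Products are `1, …, n`;
`S_i = {1,…,i}` is encoded as `Finset.Icc 1 i`, `V(S_i) = ∑_{j∈S_i} v j`, and
`ŵ(S_i) = (x i − x (i+1)) (1 + V(S_i))` with `x (n+1) = 0`.
If `x 0 ≥ x 1 ≥ … ≥ x n ≥ 0` and `x 0 + ∑_{j=1}^n v j · x j = 1`, then for each
`i ∈ {1,…,n}`:
(a) `∑_{k=i}^n ŵ(S_k) · v i / (1 + V(S_k)) = v i · x i`; and
(b) `∑_{k=i}^n ŵ(S_k) = x i + ∑_{j=1}^n v j · min (x i) (x j)`. -/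
theorem recovery_telescoping (n : ℕ) (hn : 1 ≤ n)
    (v x : ℕ → ℝ)
    (hv : ∀ i ∈ Finset.Icc 1 n, 0 < v i)
    (hdec : ∀ i < n, x (i + 1) ≤ x i)
    (hlast : 0 ≤ x n)
    (hconv : x (n + 1) = 0)
    (hsum : x 0 + ∑ j ∈ Finset.Icc 1 n, v j * x j = 1) :
    ∀ i ∈ Finset.Icc 1 n,
      (∑ k ∈ Finset.Icc i n,
          ((x k - x (k + 1)) * (1 + ∑ j ∈ Finset.Icc 1 k, v j)) *
            (v i / (1 + ∑ j ∈ Finset.Icc 1 k, v j)) = v i * x i) ∧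
      (∑ k ∈ Finset.Icc i n,
          (x k - x (k + 1)) * (1 + ∑ j ∈ Finset.Icc 1 k, v j) =
        x i + ∑ j ∈ Finset.Icc 1 n, v j * min (x i) (x j)) := by
  have anti : ∀ a b, a ≤ b → b ≤ n → x b ≤ x a := by
    intro a b hab
    induction b, hab using Nat.le_induction with
    | base => intro _; exact le_refl _
    | succ m hm ih =>
      intro h
      exact (hdec m (by omega)).trans (ih (by omega))
  intro i hi
  obtain ⟨hi1, hin⟩ := Finset.mem_Icc.mp hi
  constructor
  · have key : ∀ m, i ≤ m → ∑ k ∈ Finset.Icc i m, (x k - x (k + 1)) = x i - x (m + 1) := by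
      intro m hm
      induction m, hm using Nat.le_induction with
      | base => simp
      | succ m hm ih =>
        rw [Finset.sum_Icc_succ_top (by omega), ih]
        ring
    have h2 := key n hin
    rw [hconv, sub_zero] at h2
    rw [← h2, Finset.mul_sum]
    apply Finset.sum_congr rfl
    intro k hk
    obtain ⟨_, hkn⟩ := Finset.mem_Icc.mp hk
    have hpos : 0 ≤ ∑ j ∈ Finset.Icc 1 k, v j := by
      apply Finset.sum_nonneg
      intro j hj
      obtain ⟨h1, h3⟩ := Finset.mem_Icc.mp hj
      exact (hv j (Finset.mem_Icc.mpr ⟨h1, h3.trans hkn⟩)).le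
    have hne : 1 + ∑ j ∈ Finset.Icc 1 k, v j ≠ 0 := by linarith
    field_simp
  · have key : ∀ m, i ≤ m → m ≤ n →
        ∑ k ∈ Finset.Icc i m, (x k - x (k + 1)) * (1 + ∑ j ∈ Finset.Icc 1 k, v j) =
        x i + ∑ j ∈ Finset.Icc 1 m, v j * min (x i) (x j)
          - x (m + 1) * (1 + ∑ j ∈ Finset.Icc 1 m, v j) := by
      intro m hm
      induction m, hm using Nat.le_induction with
      | base =>
        intro _
        have h : ∑ j ∈ Finset.Icc 1 i, v j * min (x i) (x j)
            = (∑ j ∈ Finset.Icc 1 i, v j) * x i := by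
          rw [Finset.sum_mul]
          apply Finset.sum_congr rfl
          intro j hj
          rw [min_eq_left (anti j i (Finset.mem_Icc.mp hj).2 hin)]
        rw [h, Finset.Icc_self, Finset.sum_singleton]
        ring
      | succ m hm ih =>
        intro hmn
        rw [Finset.sum_Icc_succ_top (by omega), ih (by omega),
          Finset.sum_Icc_succ_top (by omega), Finset.sum_Icc_succ_top (by omega),
          min_eq_right (anti i (m + 1) (by omega) hmn)]
        ring
    rw [key n hin le_rfl, hconv]
    ring
end

section
/- (Recovering a UCB-LP solution of equal value) Fix n ≥ 1, K ≥ 0, v̂ ∈ ℝ_{>0}^n, ε ∈ ℝ_{≥0}^n, r ∈ [0,1]^n, a ∈ [0,1]^{n×K}, c ∈ ℝ_{≥0}^K, ω ∈ [0,1]. Let (x_0, x, y) with x_0 ∈ ℝ, x ∈ ℝ_{≥0}^n, y ∈ ℝ_{≥0}^{n×n} satisfy: x_0 + ∑_i v̂_i x_i = 1; x_i ≤ x_0 for all i; x_1 ≥ x_2 ≥ … ≥ x_n; y_{ij} = min{x_i, x_j} for all i,j; and the resource constraints ∑_{i=1}^n a_{ik}[ (v̂_i − ε_i) x_i − ε_i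 ∑_j v̂_j y_{ij} ] ≤ (1−ω) c_k for all k. Define S_i = {1,…,i}, V(S_i) = ∑_{j∈S_i} v̂_j, ŵ(S_i) = (x_i − x_{i+1})(1 + V(S_i)) for i = 0,…,n (with x_{n+1} = 0), and ŵ(S) = 0 for all other subsets S. Then ŵ is feasible for the UCB-LP, i.e. ŵ ≥ 0, ∑_{S⊆{1,…,n}} ŵ(S) = 1, and ∑_{S} ∑_{i∈S} a_{ik} ( v̂_i/(1+∑_{j∈S} v̂_j) − ε_i ) ŵ(S) ≤ (1−ω) c_k for all k; moreover its UCB-LP objective value equals the Compact LP objective value of (x_0,x,y): ∑_{S} ∑_{i∈S} r_i ( v̂_i/(1+∑_{j∈S} v̂_j) + ε_i ) ŵ(S) = ∑_{i=1}^n r_i [ (v̂_i + ε_i) x_i + ε_i ∑_j v̂_j y_{ij} ]. -/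
/-- The recovered distribution over nested assortments: `ŵ(S_i) = (x i − x (i+1))(1 + V(S_i))`
for `S_i = {1,…,i}` (encoded as `Finset.Icc 1 i`) with `i ≤ n`, and `ŵ(S) = 0` for all
other subsets `S`.  Note `S = Finset.Icc 1 S.card` characterizes the nested sets. -/
noncomputable def recoveredW (n : ℕ) (vh x : ℕ → ℝ) (S : Finset ℕ) : ℝ :=
  if S = Finset.Icc 1 S.card ∧ S.card ≤ n then
    (x S.card - x (S.card + 1)) * (1 + ∑ j ∈ S, vh j)
  else 0

theorem aux_powerset (n : ℕ) (vh x : ℕ → ℝ) (F : Finset ℕ → ℝ) :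
    ∑ S ∈ (Finset.Icc 1 n).powerset, F S * recoveredW n vh x S =
      ∑ m ∈ Finset.range (n + 1), F (Finset.Icc 1 m) *
        ((x m - x (m + 1)) * (1 + ∑ j ∈ Finset.Icc 1 m, vh j)) := by
  symm
  have hinj : Set.InjOn (fun m : ℕ => Finset.Icc 1 m) (Finset.range (n + 1) : Set ℕ) := by
    intro p _ q _ h
    have := congrArg Finset.card h
    simpa using this
  have h1 : ∀ m ∈ Finset.range (n + 1), F (Finset.Icc 1 m) *
        ((x m - x (m + 1)) * (1 + ∑ j ∈ Finset.Icc 1 m, vh j)) =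
        F (Finset.Icc 1 m) * recoveredW n vh x (Finset.Icc 1 m) := by
    intro m hm
    have : m ≤ n := by simpa [Nat.lt_succ_iff] using hm
    simp [recoveredW, this]
  rw [Finset.sum_congr rfl h1,
    ← Finset.sum_image (f := fun S => F S * recoveredW n vh x S) hinj]
  apply Finset.sum_subset
  · intro S hS
    obtain ⟨m, hm, rfl⟩ := Finset.mem_image.1 hS
    have : m ≤ n := by simpa [Nat.lt_succ_iff] using hm
    exact Finset.mem_powerset.2 (Finset.Icc_subset_Icc le_rfl this)
  · intro S _ hS
    have : ¬ (S = Finset.Icc 1 S.card ∧ S.card ≤ n) := by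
      rintro ⟨h, h'⟩
      exact hS (Finset.mem_image.2 ⟨S.card, by simpa [Nat.lt_succ_iff] using h', h.symm⟩)
    simp only [recoveredW, if_neg this, mul_zero]

theorem aux_total (vh x : ℕ → ℝ) (N : ℕ) :
    ∑ m ∈ Finset.range (N + 1), ((x m - x (m + 1)) * (1 + ∑ j ∈ Finset.Icc 1 m, vh j)) =
      x 0 - x (N + 1) + ∑ i ∈ Finset.Icc 1 N, vh i * (x i - x (N + 1)) := by
  induction N with
  | zero => simp
  | succ N ih =>
    rw [Finset.sum_range_succ, ih, Finset.sum_Icc_succ_top (by omega),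
      Finset.sum_Icc_succ_top (by omega)]
    simp only [mul_sub, Finset.sum_sub_distrib, ← Finset.sum_mul]
    ring

theorem aux_inner (vh x : ℕ → ℝ) (v e : ℝ) (i : ℕ) (hi : 1 ≤ i) (N : ℕ) (hN : i ≤ N) :
    ∑ m ∈ Finset.Icc i N, (v + e * (1 + ∑ j ∈ Finset.Icc 1 m, vh j)) * (x m - x (m + 1)) =
      (v + e) * (x i - x (N + 1)) +
        e * ∑ j ∈ Finset.Icc 1 N, vh j * (x (max i j) - x (N + 1)) := by
  induction N, hN using Nat.le_induction with
  | base =>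
    have : ∑ j ∈ Finset.Icc 1 i, vh j * (x (max i j) - x (i + 1)) =
        ∑ j ∈ Finset.Icc 1 i, vh j * (x i - x (i + 1)) := by
      refine Finset.sum_congr rfl fun j hj => ?_
      rw [max_eq_left (Finset.mem_Icc.1 hj).2]
    rw [this, ← Finset.sum_mul]
    simp
    ring
  | succ N hN ih =>
    rw [Finset.sum_Icc_succ_top (by omega), ih, Finset.sum_Icc_succ_top (by omega),
      Finset.sum_Icc_succ_top (by omega), max_eq_right (show i ≤ N + 1 by omega)]
    simp only [mul_sub, Finset.sum_sub_distrib, ← Finset.sum_mul]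
    ring

theorem aux_obj (n : ℕ) (vh x b e : ℕ → ℝ) (y : ℕ → ℕ → ℝ)
    (hv : ∀ i ∈ Finset.Icc 1 n, 0 < vh i) (hconv : x (n + 1) = 0)
    (hy : ∀ i ∈ Finset.Icc 1 n, ∀ j ∈ Finset.Icc 1 n, y i j = x (max i j)) :
    ∑ S ∈ (Finset.Icc 1 n).powerset,
        (∑ i ∈ S, b i * (vh i / (1 + ∑ j ∈ S, vh j) + e i)) * recoveredW n vh x S =
      ∑ i ∈ Finset.Icc 1 n,
        b i * ((vh i + e i) * x i + e i * ∑ j ∈ Finset.Icc 1 n, vh j * y i j) := by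
  rw [aux_powerset n vh x (fun S => ∑ i ∈ S, b i * (vh i / (1 + ∑ j ∈ S, vh j) + e i))]
  have h1 : ∀ m ∈ Finset.range (n + 1),
      (∑ i ∈ Finset.Icc 1 m, b i * (vh i / (1 + ∑ j ∈ Finset.Icc 1 m, vh j) + e i)) *
        ((x m - x (m + 1)) * (1 + ∑ j ∈ Finset.Icc 1 m, vh j)) =
      ∑ i ∈ Finset.Icc 1 m, b i *
        ((vh i + e i * (1 + ∑ j ∈ Finset.Icc 1 m, vh j)) * (x m - x (m + 1))) := by
    intro m hm
    have hm' : m ≤ n := by simpa [Nat.lt_succ_iff] using hm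
    have hV : 0 ≤ ∑ j ∈ Finset.Icc 1 m, vh j :=
      Finset.sum_nonneg fun j hj => (hv j (Finset.Icc_subset_Icc le_rfl hm' hj)).le
    rw [Finset.sum_mul]
    refine Finset.sum_congr rfl fun i _ => ?_
    have : 1 + ∑ j ∈ Finset.Icc 1 m, vh j ≠ 0 := by positivity
    field_simp
  rw [Finset.sum_congr rfl h1, Finset.sum_comm' (s' := fun i => Finset.Icc i n)
    (t' := Finset.Icc 1 n) (by intro p q; simp only [Finset.mem_range, Finset.mem_Icc]; omega)]
  refine Finset.sum_congr rfl fun i hi => ?_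
  have hi' := Finset.mem_Icc.1 hi
  rw [← Finset.mul_sum, aux_inner vh x (vh i) (e i) i hi'.1 n hi'.2, hconv]
  simp only [sub_zero]
  congr 3
  exact Finset.sum_congr rfl fun j hj => by rw [hy i hi j hj]

/-- Recovering a UCB-LP solution of equal value.  Products are `1, …, n`,
resources are `k : Fin K`, and subsets of `{1,…,n}` range over `(Finset.Icc 1 n).powerset`.
Given a Compact-LP point `(x 0, x, y)` with `y i j = min (x i) (x j)`, sorted coordinates
`x 1 ≥ … ≥ x n`, and satisfying the resource constraints, the recovered `ŵ` is feasible for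
the UCB-LP and its UCB-LP objective equals the Compact-LP objective of `(x 0, x, y)`. -/
theorem recovered_solution_feasible_equal_value (n K : ℕ) (hn : 1 ≤ n)
    (vh ε r : ℕ → ℝ) (a : ℕ → Fin K → ℝ) (c : Fin K → ℝ) (ω : ℝ)
    (x : ℕ → ℝ) (y : ℕ → ℕ → ℝ)
    (hv : ∀ i ∈ Finset.Icc 1 n, 0 < vh i)
    (hε : ∀ i ∈ Finset.Icc 1 n, 0 ≤ ε i)
    (hr : ∀ i ∈ Finset.Icc 1 n, r i ∈ Set.Icc (0 : ℝ) 1)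
    (ha : ∀ i ∈ Finset.Icc 1 n, ∀ k, a i k ∈ Set.Icc (0 : ℝ) 1)
    (hc : ∀ k, 0 ≤ c k) (hω : ω ∈ Set.Icc (0 : ℝ) 1)
    (hxnn : ∀ i ∈ Finset.Icc 1 n, 0 ≤ x i)
    (hynn : ∀ i ∈ Finset.Icc 1 n, ∀ j ∈ Finset.Icc 1 n, 0 ≤ y i j)
    (hsum1 : x 0 + ∑ i ∈ Finset.Icc 1 n, vh i * x i = 1)
    (hx0 : ∀ i ∈ Finset.Icc 1 n, x i ≤ x 0)
    (hsorted : ∀ i, 1 ≤ i → i < n → x (i + 1) ≤ x i)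
    (hconv : x (n + 1) = 0)
    (hy : ∀ i ∈ Finset.Icc 1 n, ∀ j ∈ Finset.Icc 1 n, y i j = min (x i) (x j))
    (hres : ∀ k, ∑ i ∈ Finset.Icc 1 n,
        a i k * ((vh i - ε i) * x i - ε i * ∑ j ∈ Finset.Icc 1 n, vh j * y i j) ≤
      (1 - ω) * c k) :
    (∀ S : Finset ℕ, 0 ≤ recoveredW n vh x S) ∧
    (∑ S ∈ (Finset.Icc 1 n).powerset, recoveredW n vh x S = 1) ∧
    (∀ k, ∑ S ∈ (Finset.Icc 1 n).powerset,
        (∑ i ∈ S, a i k * (vh i / (1 + ∑ j ∈ S, vh j) - ε i)) * recoveredW n vh x S ≤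
      (1 - ω) * c k) ∧
    (∑ S ∈ (Finset.Icc 1 n).powerset,
        (∑ i ∈ S, r i * (vh i / (1 + ∑ j ∈ S, vh j) + ε i)) * recoveredW n vh x S =
      ∑ i ∈ Finset.Icc 1 n,
        r i * ((vh i + ε i) * x i + ε i * ∑ j ∈ Finset.Icc 1 n, vh j * y i j)) := by
  have hd : ∀ m, m ≤ n → x (m + 1) ≤ x m := by
    intro m hm
    rcases Nat.eq_zero_or_pos m with rfl | h0
    · exact hx0 1 (Finset.mem_Icc.2 ⟨le_rfl, hn⟩)
    · rcases hm.lt_or_eq with h | rfl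
      · exact hsorted m h0 h
      · rw [hconv]; exact hxnn m (Finset.mem_Icc.2 ⟨h0, le_rfl⟩)
  have hanti : ∀ p q, p ≤ q → q ≤ n → x q ≤ x p := by
    intro p q hpq
    induction q, hpq using Nat.le_induction with
    | base => intro _; exact le_rfl
    | succ q _ ih => intro h; exact (hd q (by omega)).trans (ih (by omega))
  have hy' : ∀ i ∈ Finset.Icc 1 n, ∀ j ∈ Finset.Icc 1 n, y i j = x (max i j) := by
    intro i hi j hj
    rw [hy i hi j hj]
    rcases le_total i j with h | h
    · rw [max_eq_right h, min_eq_right (hanti i j h (Finset.mem_Icc.1 hj).2)]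
    · rw [max_eq_left h, min_eq_left (hanti j i h (Finset.mem_Icc.1 hi).2)]
  refine ⟨?_, ?_, ?_, ?_⟩
  · intro S
    unfold recoveredW
    split_ifs with h
    · refine mul_nonneg (sub_nonneg.2 (hd _ h.2)) (add_nonneg zero_le_one ?_)
      refine Finset.sum_nonneg fun j hj => (hv j ?_).le
      rw [h.1] at hj
      exact Finset.Icc_subset_Icc le_rfl h.2 hj
    · exact le_rfl
  · have h := aux_powerset n vh x (fun _ => 1)
    simp only [one_mul] at h
    rw [h, aux_total, hconv]
    simpa using hsum1
  · intro k
    have h := aux_obj n vh x (fun i => a i k) (fun i => - ε i) y hv hconv hy'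
    simp only [← sub_eq_add_neg, neg_mul] at h
    rw [h]
    exact hres k
  · exact aux_obj n vh x r ε y hv hconv hy'
end
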